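/- arXiv:2502.18830 — 4 statements merged into one kernel-verified Lean document; each statement's English description precedes it below -/
import Mathlib

section
/- Let A = Q_x R_x and B = Q_y R_y, and suppose R_x R_yᵀ = U Σ Vᵀ with U a k × k orthogonal matrix (Uᵀ U = I) and Σ diagonal. Then B R_xᵀ U = Q_y V Σ. If moreover every diagonal entry of Σ is strictly positive, then Q_y V √Σ = B R_xᵀ U (√Σ)⁻¹. -/
/-- with `B = Qy * Ry` and `Rx * Ryᵀ = U * Σ * Vᵀ`, `U` orthogonal and `Σ`
diagonal, one has `B * Rxᵀ * U = Qy * V * Σ`; if moreover all diagonal entries of `Σ` are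
strictly positive, then `Qy * V * √Σ = B * Rxᵀ * U * (√Σ)⁻¹`. -/
theorem recover_aligned_factor_y
    {my k : ℕ}
    (B : Matrix (Fin my) (Fin k) ℝ)
    (Qy : Matrix (Fin my) (Fin k) ℝ) (Rx Ry : Matrix (Fin k) (Fin k) ℝ)
    (U V : Matrix (Fin k) (Fin k) ℝ) (σ : Fin k → ℝ)
    (hB : B = Qy * Ry)
    (hU : U.transpose * U = 1)
    (hSVD : Rx * Ry.transpose = U * Matrix.diagonal σ * V.transpose) :
    B * Rx.transpose * U = Qy * V * Matrix.diagonal σ ∧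
    ((∀ j, 0 < σ j) →
      Qy * V * Matrix.diagonal (fun j => Real.sqrt (σ j)) =
        B * Rx.transpose * U * Matrix.diagonal fun j => (Real.sqrt (σ j))⁻¹) := by
  have hT : Ry * Rx.transpose = V * Matrix.diagonal σ * U.transpose := by
    simpa [Matrix.mul_assoc] using congrArg Matrix.transpose hSVD
  have hBU : B * Rx.transpose * U = Qy * V * Matrix.diagonal σ := by
    rw [hB, Matrix.mul_assoc Qy, hT]
    simp only [Matrix.mul_assoc, hU, Matrix.mul_one]
  refine ⟨hBU, fun _ => ?_⟩
  rw [hBU, Matrix.mul_assoc _ (Matrix.diagonal σ), Matrix.diagonal_mul_diagonal]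
  congr 3 with j
  rw [← div_eq_mul_inv, Real.div_sqrt]
end

section
/- Let A = Q_x R_x and suppose R_x R_yᵀ = U Σ Vᵀ with V orthogonal (Vᵀ V = I) and Σ diagonal with σ_j > 0 for a fixed index j. Then A − (1/σ_j) A R_yᵀ v_j u_jᵀ R_x = A − Q_x u_j u_jᵀ R_x; that is, the projection-form update used in line 21 of the DS-COD update algorithm coincides with the update Ā = A − Q_x u_j u_jᵀ R_x of Lemma 1. -/
/-- with `A = Qx * Rx`, `Rx * Ryᵀ = U * Σ * Vᵀ`, `V` orthogonal, `Σ` diagonal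
and `σ j > 0`, the projection-form update `A - (1/σ_j) A Ryᵀ v_j u_jᵀ Rx` coincides with
the update `Ā = A - Qx u_j u_jᵀ Rx` of Lemma 1. -/
theorem projection_update_eq
    {mx k : ℕ}
    (A : Matrix (Fin mx) (Fin k) ℝ)
    (Qx : Matrix (Fin mx) (Fin k) ℝ) (Rx Ry : Matrix (Fin k) (Fin k) ℝ)
    (U V : Matrix (Fin k) (Fin k) ℝ) (σ : Fin k → ℝ)
    (hA : A = Qx * Rx)
    (hV : V.transpose * V = 1)
    (hSVD : Rx * Ry.transpose = U * Matrix.diagonal σ * V.transpose)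
    (j : Fin k) (hσj : 0 < σ j)
    (uj vj : Fin k → ℝ)
    (huj : uj = fun i => U i j) (hvj : vj = fun i => V i j) :
    A - (σ j)⁻¹ • (A * Ry.transpose * Matrix.vecMulVec vj uj * Rx) =
      A - Qx * Matrix.vecMulVec uj uj * Rx := by
  have hvj' : vj = V.mulVec (Pi.single j 1) := by rw [hvj, Matrix.mulVec_single_one]; rfl
  have huj' : uj = U.mulVec (Pi.single j 1) := by rw [huj, Matrix.mulVec_single_one]; rfl
  have hdiag : (Matrix.diagonal σ).mulVec (Pi.single j 1) = σ j • Pi.single j (1 : ℝ) := by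
    rw [Matrix.diagonal_mulVec_single, ← Pi.single_smul, smul_eq_mul]
  have hsing : (Rx * Ry.transpose).mulVec vj = σ j • uj := by
    rw [hSVD, hvj', Matrix.mulVec_mulVec, Matrix.mul_assoc, hV, Matrix.mul_one,
      ← Matrix.mulVec_mulVec, hdiag, Matrix.mulVec_smul, huj']
  rw [hA, Matrix.mul_assoc Qx, Matrix.mul_assoc Qx, Matrix.mul_vecMulVec, hsing,
    Matrix.smul_vecMulVec, Matrix.mul_smul, Matrix.smul_mul, inv_smul_smul₀ hσj.ne']
end

section
/- Suppose R_x R_yᵀ = U Σ Vᵀ with U, V orthogonal k × k matrices (Uᵀ U = I, Vᵀ V = I) and Σ diagonal with σ_j > 0 for a fixed index j. Then the k × k matrix P_A = (1/σ_j) R_yᵀ v_j u_jᵀ R_x is idempotent: P_A² = P_A. Likewise P_B = (1/σ_j) R_xᵀ u_j v_jᵀ R_y satisfies P_B² = P_B. -/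
namespace Matrix

theorem vecMulVec_mul_mul_vecMulVec {m n R : Type*} [Fintype m] [Fintype n] [CommSemiring R]
    (v : m → R) (u : n → R) (M : Matrix n m R) :
    vecMulVec v u * M * vecMulVec v u = (u ⬝ᵥ M *ᵥ v) • vecMulVec v u := by
  rw [Matrix.mul_assoc, mul_vecMulVec, vecMulVec_mul_vecMulVec, vecMulVec_smul]

theorem isIdempotentElem_inv_smul_mul_vecMulVec_mul {l m n K : Type*} [Fintype l] [Fintype m]
    [Fintype n] [Field K] (A : Matrix n l K) (B : Matrix l m K) (u : n → K) (v : m → K) {s : K}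
    (hs : s ≠ 0) (h : u ⬝ᵥ (A * B) *ᵥ v = s) :
    IsIdempotentElem (s⁻¹ • (B * vecMulVec v u * A)) := by
  have key : B * vecMulVec v u * A * (B * vecMulVec v u * A) = s • (B * vecMulVec v u * A) := by
    calc B * vecMulVec v u * A * (B * vecMulVec v u * A)
        = B * (vecMulVec v u * (A * B) * vecMulVec v u) * A := by simp only [Matrix.mul_assoc]
      _ = s • (B * vecMulVec v u * A) := by
        rw [vecMulVec_mul_mul_vecMulVec, h, Matrix.mul_smul, Matrix.smul_mul]
  rw [IsIdempotentElem, Matrix.smul_mul, Matrix.mul_smul, key, inv_smul_smul₀ hs]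

theorem col_dotProduct_mul_diagonal_mul_transpose_mulVec_col {n R : Type*} [Fintype n]
    [DecidableEq n] [CommRing R] (U V : Matrix n n R) (σ : n → R)
    (hU : Uᵀ * U = 1) (hV : Vᵀ * V = 1) (j : n) :
    U.col j ⬝ᵥ (U * diagonal σ * Vᵀ) *ᵥ V.col j = σ j := by
  rw [← mulVec_single_one V, mulVec_mulVec, Matrix.mul_assoc _ Vᵀ, hV, Matrix.mul_one,
    ← mulVec_single_one U, dotProduct_comm, dotProduct_mulVec, ← mulVec_transpose,
    mulVec_mulVec, ← Matrix.mul_assoc, hU, Matrix.one_mul]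
  simp

end Matrix

/-- if `Rx * Ryᵀ = U * Σ * Vᵀ` with `U, V` orthogonal, `Σ` diagonal and
`σ j > 0`, then `P_A = (1/σ_j) Ryᵀ v_j u_jᵀ Rx` and `P_B = (1/σ_j) Rxᵀ u_j v_jᵀ Ry`
are idempotent. -/
theorem projections_idempotent
    {k : ℕ}
    (Rx Ry : Matrix (Fin k) (Fin k) ℝ)
    (U V : Matrix (Fin k) (Fin k) ℝ) (σ : Fin k → ℝ)
    (hU : U.transpose * U = 1) (hV : V.transpose * V = 1)
    (hSVD : Rx * Ry.transpose = U * Matrix.diagonal σ * V.transpose)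
    (j : Fin k) (hσj : 0 < σ j)
    (uj vj : Fin k → ℝ)
    (huj : uj = fun i => U i j) (hvj : vj = fun i => V i j)
    (PA PB : Matrix (Fin k) (Fin k) ℝ)
    (hPA : PA = (σ j)⁻¹ • (Ry.transpose * Matrix.vecMulVec vj uj * Rx))
    (hPB : PB = (σ j)⁻¹ • (Rx.transpose * Matrix.vecMulVec uj vj * Ry)) :
    PA * PA = PA ∧ PB * PB = PB := by
  subst huj hvj hPA hPB
  have hSVD' : Ry * Rx.transpose = V * Matrix.diagonal σ * U.transpose := by
    simpa [Matrix.mul_assoc] using congrArg Matrix.transpose hSVD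
  refine ⟨Matrix.isIdempotentElem_inv_smul_mul_vecMulVec_mul _ _ _ _ hσj.ne' ?_,
    Matrix.isIdempotentElem_inv_smul_mul_vecMulVec_mul _ _ _ _ hσj.ne' ?_⟩
  · rw [hSVD]
    exact Matrix.col_dotProduct_mul_diagonal_mul_transpose_mulVec_col U V σ hU hV j
  · rw [hSVD']
    exact Matrix.col_dotProduct_mul_diagonal_mul_transpose_mulVec_col V U σ hV hU j
end

section
/- Let A = Q_x R_x and B = Q_y R_y with Q_x, Q_y having orthonormal columns (Q_xᵀ Q_x = I, Q_yᵀ Q_y = I), and let R_x R_yᵀ = U Σ Vᵀ with U, V orthogonal k × k matrices and Σ diagonal with nonnegative entries σ_1,…,σ_k. Let J be a set of indices, and let Σ_J be Σ with the diagonal entries indexed by J replaced by 0. Define Ā = A − Q_x (∑_{j∈J} u_j u_jᵀ) R_x and B̄ = B − Q_y (∑_{j∈J} v_j v_jᵀ) R_y. Then Ā B̄ᵀ = Q_x U Σ_J Vᵀ Q_yᵀ, and the spectral norm of Ā B̄ᵀ equals the maximum of σ_i over i ∉ J (and 0 if J contains all indices). In particular, if J = { j : σ_j ≥ θ } then σ_1(Ā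 B̄ᵀ) < θ. -/
/-- The spectral norm (ℓ2 → ℓ2 operator norm, i.e. largest singular value) of a real
matrix. -/
noncomputable def specNorm {m n : ℕ} (M : Matrix (Fin m) (Fin n) ℝ) : ℝ :=
  ‖LinearMap.toContinuousLinearMap (Matrix.toEuclideanLin M)‖

open scoped Matrix.Norms.L2Operator in
theorem specNorm_eq_l2_opNorm {m n : ℕ} (M : Matrix (Fin m) (Fin n) ℝ) : specNorm M = ‖M‖ := by
  rw [Matrix.l2_opNorm_def]
  rfl

open scoped Matrix.Norms.L2Operator in
theorem specNorm_transpose {m n : ℕ} (M : Matrix (Fin m) (Fin n) ℝ) :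
    specNorm M.transpose = specNorm M := by
  rw [specNorm_eq_l2_opNorm, specNorm_eq_l2_opNorm, ← Matrix.conjTranspose_eq_transpose_of_trivial,
    Matrix.l2_opNorm_conjTranspose]

open scoped Matrix.Norms.L2Operator in
theorem specNorm_diagonal {n : ℕ} (v : Fin n → ℝ) : specNorm (Matrix.diagonal v) = ‖v‖ := by
  rw [specNorm_eq_l2_opNorm, Matrix.l2_opNorm_diagonal]

open scoped Matrix.Norms.L2Operator in
/-- Multiplying on the left by a matrix with orthonormal columns preserves the spectral norm. -/
theorem specNorm_mul_of_transpose_mul_self {l m n : ℕ} {W : Matrix (Fin l) (Fin m) ℝ}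
    (hW : W.transpose * W = 1) (M : Matrix (Fin m) (Fin n) ℝ) :
    specNorm (W * M) = specNorm M := by
  simp only [specNorm_eq_l2_opNorm]
  refine (mul_self_inj (norm_nonneg _) (norm_nonneg _)).1 ?_
  rw [← Matrix.l2_opNorm_conjTranspose_mul_self, ← Matrix.l2_opNorm_conjTranspose_mul_self]
  simp only [Matrix.conjTranspose_eq_transpose_of_trivial, Matrix.transpose_mul]
  rw [Matrix.mul_assoc, ← Matrix.mul_assoc W.transpose, hW, Matrix.one_mul]

theorem specNorm_mul_transpose_of_transpose_mul_self {l m n : ℕ} {W : Matrix (Fin l) (Fin m) ℝ}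
    (hW : W.transpose * W = 1) (M : Matrix (Fin n) (Fin m) ℝ) :
    specNorm (M * W.transpose) = specNorm M := by
  rw [← specNorm_transpose, Matrix.transpose_mul, Matrix.transpose_transpose,
    specNorm_mul_of_transpose_mul_self hW, specNorm_transpose]

theorem sum_vecMulVec_col {m n : ℕ} (U : Matrix (Fin m) (Fin n) ℝ) (J : Finset (Fin n)) :
    ∑ j ∈ J, Matrix.vecMulVec (fun i => U i j) (fun i => U i j) =
      U * Matrix.diagonal (fun j => if j ∈ J then (1 : ℝ) else 0) * U.transpose := by
  ext a b
  rw [Matrix.mul_apply]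
  simp [Matrix.sum_apply, Matrix.vecMulVec_apply]

/-- Removing the projection onto the columns indexed by `J` zeroes these columns. -/
theorem one_sub_sum_vecMulVec_col_mul {m n : ℕ} {U : Matrix (Fin m) (Fin n) ℝ}
    (hU : U.transpose * U = 1) (J : Finset (Fin n)) :
    (1 - ∑ j ∈ J, Matrix.vecMulVec (fun i => U i j) (fun i => U i j)) * U =
      U * Matrix.diagonal (fun j => if j ∈ J then (0 : ℝ) else 1) := by
  rw [sum_vecMulVec_col, Matrix.sub_mul, Matrix.one_mul, Matrix.mul_assoc _ U.transpose, hU,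
    Matrix.mul_one]
  ext a b
  by_cases hb : b ∈ J <;> simp [hb]

theorem norm_zeroed_eq_sup' {n : ℕ} {σ : Fin n → ℝ} (hσ : ∀ i, 0 ≤ σ i) (J : Finset (Fin n))
    (h : (Finset.univ \ J).Nonempty) :
    ‖fun i => if i ∈ J then 0 else σ i‖ = (Finset.univ \ J).sup' h σ := by
  obtain ⟨i₀, hi₀⟩ := h
  have hsup : 0 ≤ (Finset.univ \ J).sup' ⟨i₀, hi₀⟩ σ := (hσ i₀).trans (Finset.le_sup' σ hi₀)
  refine le_antisymm ((pi_norm_le_iff_of_nonneg hsup).2 fun i => ?_)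
    (Finset.sup'_le _ _ fun i hi => ?_)
  · by_cases hi : i ∈ J
    · simpa [hi] using hsup
    · simpa [hi, abs_of_nonneg (hσ i)] using
        Finset.le_sup' σ (Finset.mem_sdiff.2 ⟨Finset.mem_univ i, hi⟩)
  · have hle := norm_le_pi_norm (fun i => if i ∈ J then 0 else σ i) i
    simpa [(Finset.mem_sdiff.1 hi).2, abs_of_nonneg (hσ i)] using hle

/-- after dumping the snapshots indexed by `J`, the buffers satisfy
`Ā B̄ᵀ = Qx U Σ_J Vᵀ Qyᵀ` (where `Σ_J` is `Σ` with the entries in `J` zeroed out), the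
spectral norm of `Ā B̄ᵀ` is the maximum of `σ i` over `i ∉ J` (and `0` when `J` is
everything); in particular if `J = {j : σ j ≥ θ}` with `θ > 0` then `σ₁(Ā B̄ᵀ) < θ`. -/
theorem dump_snapshots_residual
    {mx my k : ℕ}
    (A : Matrix (Fin mx) (Fin k) ℝ) (B : Matrix (Fin my) (Fin k) ℝ)
    (Qx : Matrix (Fin mx) (Fin k) ℝ) (Rx : Matrix (Fin k) (Fin k) ℝ)
    (Qy : Matrix (Fin my) (Fin k) ℝ) (Ry : Matrix (Fin k) (Fin k) ℝ)
    (U V : Matrix (Fin k) (Fin k) ℝ) (σ : Fin k → ℝ)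
    (hA : A = Qx * Rx) (hB : B = Qy * Ry)
    (hQx : Qx.transpose * Qx = 1) (hQy : Qy.transpose * Qy = 1)
    (hU : U.transpose * U = 1) (hV : V.transpose * V = 1)
    (hσ : ∀ i, 0 ≤ σ i)
    (hSVD : Rx * Ry.transpose = U * Matrix.diagonal σ * V.transpose)
    (J : Finset (Fin k))
    (SigmaJ : Matrix (Fin k) (Fin k) ℝ)
    (hSigmaJ : SigmaJ = Matrix.diagonal fun i => if i ∈ J then 0 else σ i)
    (Abar : Matrix (Fin mx) (Fin k) ℝ) (Bbar : Matrix (Fin my) (Fin k) ℝ)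
    (hAbar : Abar = A - Qx * (∑ j ∈ J, Matrix.vecMulVec (fun i => U i j) fun i => U i j) * Rx)
    (hBbar : Bbar = B - Qy * (∑ j ∈ J, Matrix.vecMulVec (fun i => V i j) fun i => V i j) * Ry) :
    Abar * Bbar.transpose = Qx * U * SigmaJ * V.transpose * Qy.transpose ∧
    (∀ h : (Finset.univ \ J).Nonempty,
      specNorm (Abar * Bbar.transpose) = (Finset.univ \ J).sup' h σ) ∧
    (J = Finset.univ → specNorm (Abar * Bbar.transpose) = 0) ∧
    (∀ θ : ℝ, 0 < θ → (∀ i, i ∈ J ↔ θ ≤ σ i) →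
      specNorm (Abar * Bbar.transpose) < θ) := by
  have hprod : Abar * Bbar.transpose = Qx * U * SigmaJ * V.transpose * Qy.transpose := by
    set P := ∑ j ∈ J, Matrix.vecMulVec (fun i => U i j) fun i => U i j with hP
    set R := ∑ j ∈ J, Matrix.vecMulVec (fun i => V i j) fun i => V i j with hR
    have hA' : Abar = Qx * ((1 - P) * Rx) := by
      rw [hAbar, hA, Matrix.sub_mul, Matrix.mul_sub, Matrix.one_mul, Matrix.mul_assoc]
    have hB' : Bbar = Qy * ((1 - R) * Ry) := by
      rw [hBbar, hB, Matrix.sub_mul, Matrix.mul_sub, Matrix.one_mul, Matrix.mul_assoc]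
    have hdiag : SigmaJ = Matrix.diagonal (fun j => if j ∈ J then 0 else 1) *
        Matrix.diagonal σ * (Matrix.diagonal fun j => if j ∈ J then 0 else 1) := by
      rw [hSigmaJ, Matrix.diagonal_mul_diagonal, Matrix.diagonal_mul_diagonal]
      congr 1
      ext i
      by_cases hi : i ∈ J <;> simp [hi]
    calc Abar * Bbar.transpose
        = Qx * ((1 - P) * (Rx * Ry.transpose) * (1 - R).transpose) * Qy.transpose := by
          simp only [hA', hB', Matrix.transpose_mul, Matrix.mul_assoc]
      _ = Qx * (((1 - P) * U) * Matrix.diagonal σ * ((1 - R) * V).transpose) * Qy.transpose := by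
          simp only [hSVD, Matrix.transpose_mul, Matrix.mul_assoc]
      _ = Qx * U * SigmaJ * V.transpose * Qy.transpose := by
          rw [hP, hR, one_sub_sum_vecMulVec_col_mul hU, one_sub_sum_vecMulVec_col_mul hV, hdiag]
          simp only [Matrix.transpose_mul, Matrix.diagonal_transpose, Matrix.mul_assoc]
  have hnorm : specNorm (Abar * Bbar.transpose) = ‖fun i => if i ∈ J then 0 else σ i‖ := by
    rw [hprod, specNorm_mul_transpose_of_transpose_mul_self hQy,
      specNorm_mul_transpose_of_transpose_mul_self hV, Matrix.mul_assoc,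
      specNorm_mul_of_transpose_mul_self hQx, specNorm_mul_of_transpose_mul_self hU, hSigmaJ,
      specNorm_diagonal]
  refine ⟨hprod, fun h => hnorm.trans (norm_zeroed_eq_sup' hσ J h), fun h => ?_,
    fun θ hθ hJ => ?_⟩
  · rw [hnorm, norm_eq_zero]
    ext i
    simp [h]
  · rw [hnorm, pi_norm_lt_iff hθ]
    intro i
    by_cases hi : i ∈ J
    · simpa [hi] using hθ
    · simpa [hi, abs_of_nonneg (hσ i)] using lt_of_not_ge fun hle => hi ((hJ i).2 hle)
end
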